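/- arXiv:0709.1615 — 2 statements merged into one kernel-verified Lean document; each statement's English description precedes it below -/
import Mathlib

section
/- (Guralnick–Perkinson dimension formula) Let G be a finite group and ρ : G → GL(V) a representation on a finite-dimensional real vector space V. Then the dimension of the affine hull of the representation polytope P(ρ) equals the sum, over (isomorphism classes of) nontrivial irreducible complex representations σ of G that occur with positive multiplicity in the complexification of ρ, of (deg σ)², where deg σ is the dimension of the representation space of σ. -/
variable {G : Type*} [Group G] [Fintype G]

/-- A complex representation is irreducible if its space is nonzero and has no proper
nonzero invariant subspace. -/
def IsIrreducibleRep {W : Type*} [AddCommGroup W] [Module ℂ W]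
    (σ : Representation ℂ G W) : Prop :=
  Nontrivial W ∧
    ∀ U : Submodule ℂ W, (∀ g : G, ∀ x ∈ U, σ g x ∈ U) → U = ⊥ ∨ U = ⊤

/-- `σ` is an irreducible factor of the real representation `ρ`: it occurs with positive
multiplicity in the complexification of `ρ`. -/
def IsFactor {V : Type*} [AddCommGroup V] [Module ℝ V] {m : ℕ}
    (σ : Representation ℂ G (Fin m → ℂ)) (ρ : Representation ℝ G V) : Prop :=
  ((Fintype.card G : ℂ)⁻¹ *
    ∑ g : G, ((LinearMap.trace ℝ V (ρ g) : ℝ) : ℂ) *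
      (starRingEnd ℂ) (LinearMap.trace ℂ (Fin m → ℂ) (σ g))) ≠ 0

/-- The character of a complex representation. -/
noncomputable def rchar {m : ℕ} (σ : Representation ℂ G (Fin m → ℂ)) : G → ℂ :=
  fun g => LinearMap.trace ℂ (Fin m → ℂ) (σ g)

section

set_option linter.unusedSectionVars false

open Representation

theorem IsIrreducibleRep.isIrreducible {W : Type*} [AddCommGroup W] [Module ℂ W]
    {σ : Representation ℂ G W} (h : IsIrreducibleRep σ) : σ.IsIrreducible := by
  obtain ⟨hW, hU⟩ := h
  have : Nontrivial (Subrepresentation σ) :=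
    ⟨⊥, ⊤, fun e => bot_ne_top (α := Submodule ℂ W) (congrArg Subrepresentation.toSubmodule e)⟩
  refine ⟨fun U => ?_⟩
  rcases hU U.toSubmodule fun g x hx => U.apply_mem_toSubmodule g hx with h | h
  · exact Or.inl (Subrepresentation.toSubmodule_injective h)
  · exact Or.inr (Subrepresentation.toSubmodule_injective h)

/-- Every finite-dimensional complex representation of a finite group is spanned by the images of
the intertwining maps from irreducible representations. -/
theorem eq_top_of_forall_intertwiningMap_mem {W : Type*} [AddCommGroup W] [Module ℂ W]
    [FiniteDimensional ℂ W] (r : Representation ℂ G W) (T : Submodule ℂ W)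
    (hT : ∀ (m : ℕ) (τ : Representation ℂ G (Fin m → ℂ)), IsIrreducibleRep τ →
      ∀ (f : IntertwiningMap τ r) (x : Fin m → ℂ), f x ∈ T) : T = ⊤ := by
  induction hn : Module.finrank ℂ W using Nat.strong_induction_on generalizing W with
  | _ n ih =>
    have key (U : Subrepresentation r) (hU : U.toSubmodule ≠ ⊤) : U.toSubmodule ≤ T := by
      have := ih _ (hn ▸ Submodule.finrank_lt hU) U.toRepresentation
        (T.comap U.toSubmodule.subtype) (fun m τ hτ f x => by
          exact hT m τ hτ ⟨U.toSubmodule.subtype ∘ₗ f.toLinearMap, fun g => by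
            refine LinearMap.ext fun y => ?_
            exact congrArg Subtype.val (IntertwiningMap.isIntertwining _ _ f g y)⟩ x) rfl
      exact Submodule.comap_subtype_eq_top.mp this
    rcases subsingleton_or_nontrivial W with hW | hW
    · exact Subsingleton.elim _ _
    by_cases hirr : IsIrreducibleRep r
    · let e : W ≃ₗ[ℂ] (Fin n → ℂ) := LinearEquiv.ofFinrankEq _ _ (by simp [hn])
      let τ : Representation ℂ G (Fin n → ℂ) := (e.conjRingEquiv : _ →* _).comp r
      have hτ (g : G) (x : W) : τ g (e x) = e (r g x) := by
        simp [τ, LinearEquiv.conjRingEquiv]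
      have hτirr : IsIrreducibleRep τ := by
        refine ⟨e.symm.toEquiv.nontrivial, fun U hU => ?_⟩
        rcases hirr.2 (U.comap (e : W →ₗ[ℂ] _)) (fun g x hx => by
          have := hU g _ hx
          simpa [hτ] using this) with h | h
        · left
          rw [eq_bot_iff]
          intro x hx
          have : e.symm x ∈ U.comap (e : W →ₗ[ℂ] _) := by simpa using hx
          rw [h, Submodule.mem_bot] at this
          simpa using this
        · right
          rw [eq_top_iff]
          intro x _
          have : e.symm x ∈ U.comap (e : W →ₗ[ℂ] _) := h ▸ Submodule.mem_top
          simpa using this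
      rw [eq_top_iff]
      intro x _
      have := hT n τ hτirr ⟨(e.symm : _ →ₗ[ℂ] W), fun g => by
        refine LinearMap.ext fun y => ?_
        obtain ⟨y, rfl⟩ := e.surjective y
        simp [hτ]⟩ (e x)
      simpa using this
    · have : ∃ U : Submodule ℂ W, (∀ g : G, ∀ x ∈ U, r g x ∈ U) ∧ U ≠ ⊥ ∧ U ≠ ⊤ := by
        by_contra! h
        exact hirr ⟨hW, fun U hU => or_iff_not_imp_left.mpr (h U hU)⟩
      obtain ⟨U, hU, hbot, htop⟩ := this
      obtain ⟨U', hU'⟩ := exists_isCompl (⟨U, fun g x hx => hU g x hx⟩ : Subrepresentation r)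
      have hsup : U ⊔ U'.toSubmodule = ⊤ :=
        congrArg Subrepresentation.toSubmodule hU'.sup_eq_top
      have hinf : U ⊓ U'.toSubmodule = ⊥ :=
        congrArg Subrepresentation.toSubmodule hU'.inf_eq_bot
      rw [eq_top_iff, ← hsup]
      refine sup_le (key ⟨U, fun g x hx => hU g x hx⟩ htop) (key U' fun h => hbot ?_)
      simpa [h] using hinf

/-- The character of a complex representation of a finite group satisfies `χ(g⁻¹) = conj χ(g)`. -/
theorem character_inv_eq_conj {m : ℕ} (σ : Representation ℂ G (Fin m → ℂ)) (g : G) :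
    σ.character g⁻¹ = (starRingEnd ℂ) (σ.character g) := by
  open scoped Matrix ComplexOrder in
  let M : G → Matrix (Fin m) (Fin m) ℂ := fun h => LinearMap.toMatrix' (σ h)
  have hM (a b : G) : M (a * b) = M a * M b := by simp [M, LinearMap.toMatrix'_mul]
  have hone : M 1 = 1 := by simp [M]
  have htr (h : G) : σ.character h = (M h).trace := by
    simp [M, character, LinearMap.trace_eq_matrix_trace ℂ (Pi.basisFun ℂ (Fin m)),
      LinearMap.toMatrix_eq_toMatrix']
  let P := ∑ h, (M h)ᴴ * M h
  have hP : IsUnit P := by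
    refine Matrix.PosDef.isUnit ?_
    classical
    have : P = 1 + ∑ h ∈ Finset.univ.erase 1, (M h)ᴴ * M h := by
      simp only [P]
      rw [← Finset.add_sum_erase _ _ (Finset.mem_univ (1 : G))]
      simp [hone]
    rw [this]
    exact Matrix.PosDef.one.add_posSemidef
      (Matrix.posSemidef_sum _ fun h _ => Matrix.posSemidef_conjTranspose_mul_self _)
  have hinv : (M g)ᴴ * P = P * M g⁻¹ := by
    have : (M g)ᴴ * P * M g = P := by
      simp only [P, Finset.mul_sum, Finset.sum_mul]
      refine Fintype.sum_equiv (Equiv.mulRight g) _ _ fun h => ?_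
      simp [hM, Matrix.mul_assoc]
    conv_rhs => rw [← this]
    rw [Matrix.mul_assoc _ (M g), ← hM, mul_inv_cancel, hone, mul_one]
  have hdet : IsUnit P.det := (Matrix.isUnit_iff_isUnit_det P).mp hP
  have : M g⁻¹ = P⁻¹ * ((M g)ᴴ * P) := by
    rw [hinv, ← Matrix.mul_assoc, Matrix.nonsing_inv_mul _ hdet, one_mul]
  rw [htr, htr, this, Matrix.trace_mul_comm, Matrix.mul_assoc, Matrix.mul_nonsing_inv _ hdet,
    mul_one, Matrix.trace_conjTranspose]
  rfl

/-- The real span of a family of real functions and the complex span of its complexification have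
the same dimension. -/
theorem finrank_span_ofReal_comp {ι α : Type*} [Finite α] (f : ι → α → ℝ) :
    Module.finrank ℂ (Submodule.span ℂ (Set.range fun i a => (f i a : ℂ))) =
      Module.finrank ℝ (Submodule.span ℝ (Set.range f)) := by
  obtain ⟨t, ht, hspan, hli⟩ := exists_linearIndependent ℝ (Set.range f)
  let c : (α → ℝ) →ₗ[ℝ] (α → ℂ) := Complex.ofRealCLM.toLinearMap.compLeft α
  have : Finite t := hli.finite
  have := Fintype.ofFinite t
  have hli' : LinearIndependent ℂ fun x : t => c x := by
    rw [Fintype.linearIndependent_iff] at hli ⊢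
    intro z hz
    have hre := hli (fun x => (z x).re) (by
      ext a
      have := congrArg Complex.re (congrFun hz a)
      simpa [c, Finset.sum_apply] using this)
    have him := hli (fun x => (z x).im) (by
      ext a
      have := congrArg Complex.im (congrFun hz a)
      simpa [c, Finset.sum_apply] using this)
    exact fun x => Complex.ext (hre x) (him x)
  have hspan' : Submodule.span ℂ (Set.range fun i a => (f i a : ℂ)) =
      Submodule.span ℂ (Set.range fun x : t => c x) := by
    apply le_antisymm
    · rw [Submodule.span_le]
      rintro _ ⟨i, rfl⟩
      have hi : f i ∈ Submodule.span ℝ t := hspan ▸ Submodule.subset_span ⟨i, rfl⟩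
      have : Submodule.span ℝ t ≤ ((Submodule.span ℂ (Set.range fun x : t => c x)).restrictScalars
          ℝ).comap c := by
        rw [Submodule.span_le]
        intro x hx
        exact Submodule.subset_span ⟨⟨x, hx⟩, rfl⟩
      exact this hi
    · rw [Submodule.span_le]
      rintro _ ⟨⟨x, hx⟩, rfl⟩
      obtain ⟨i, rfl⟩ := ht hx
      exact Submodule.subset_span ⟨i, rfl⟩
  rw [hspan', finrank_span_eq_card hli', ← hspan, ← finrank_span_eq_card hli, Subtype.range_coe]

/-- The matrix coefficient `g ↦ φ (r g v)`, normalised to have mean zero over the group. -/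
noncomputable def centeredCoeff {K W : Type*} [Field K] [AddCommGroup W] [Module K W]
    (r : Representation K G W) : Module.Dual K W →ₗ[K] W →ₗ[K] (G → K) :=
  LinearMap.mk₂ K
    (fun φ v g => φ (r g v) - (Fintype.card G : K)⁻¹ * ∑ h, φ (r h v))
    (fun φ ψ v => by ext g; simp [Finset.sum_add_distrib]; ring)
    (fun c φ v => by ext g; simp [← Finset.mul_sum]; ring)
    (fun φ v w => by ext g; simp [Finset.sum_add_distrib]; ring)
    (fun c φ v => by ext g; simp [← Finset.mul_sum]; ring)

theorem centeredCoeff_apply {K W : Type*} [Field K] [AddCommGroup W] [Module K W]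
    (r : Representation K G W) (φ : Module.Dual K W) (v : W) (g : G) :
    centeredCoeff r φ v g = φ (r g v) - (Fintype.card G : K)⁻¹ * ∑ h, φ (r h v) := rfl

theorem centeredCoeff_intertwiningMap {K W W' : Type*} [Field K] [AddCommGroup W] [Module K W]
    [AddCommGroup W'] [Module K W'] {τ : Representation K G W'} {r : Representation K G W}
    (f : IntertwiningMap τ r) (φ : Module.Dual K W) (v : W') :
    centeredCoeff r φ (f v) = centeredCoeff τ (φ ∘ₗ f.toLinearMap) v := by
  ext g
  simp [centeredCoeff_apply, IntertwiningMap.isIntertwining]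

theorem centeredCoeff_mem_span {K ι : Type*} [Field K] [Fintype ι] [DecidableEq ι]
    (r : Representation K G (ι → K)) (φ : Module.Dual K (ι → K)) (v : ι → K) :
    centeredCoeff r φ v ∈ Submodule.span K (Set.range fun p : ι × ι =>
      centeredCoeff r (LinearMap.proj p.1) (Pi.single p.2 1)) := by
  have hφ : φ = ∑ a, φ (Pi.single a 1) • LinearMap.proj a := by
    refine (Pi.basisFun K ι).ext fun b => ?_
    simp [Pi.single_apply, LinearMap.sum_apply]
  have hv : v = ∑ b, v b • Pi.single b 1 := by
    ext b
    simp [Finset.sum_apply, Pi.single_apply]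
  rw [hφ, map_sum, LinearMap.sum_apply, hv]
  refine Submodule.sum_mem _ fun a _ => ?_
  rw [map_sum]
  refine Submodule.sum_mem _ fun b _ => ?_
  rw [map_smul, map_smul, LinearMap.smul_apply]
  exact Submodule.smul_mem _ _ (Submodule.smul_mem _ _ (Submodule.subset_span ⟨(a, b), rfl⟩))

/-- The matrix coefficients of a nontrivial irreducible representation have mean zero. -/
theorem centeredCoeff_apply_of_isIrreducibleRep {W : Type*} [AddCommGroup W] [Module ℂ W]
    {σ : Representation ℂ G W} (hσ : IsIrreducibleRep σ) (hnt : ∃ g, σ g ≠ 1)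
    (φ : Module.Dual ℂ W) (v : W) (g : G) : centeredCoeff σ φ v g = φ (σ g v) := by
  have hinv : invariants σ = ⊥ := by
    refine (hσ.2 (invariants σ) fun g x hx => ?_).resolve_right fun h => ?_
    · rwa [hx g]
    · obtain ⟨g, hg⟩ := hnt
      refine hg (LinearMap.ext fun x => ?_)
      have : x ∈ invariants σ := h ▸ Submodule.mem_top
      exact this g
  have hsum : ∑ h, σ h v ∈ invariants σ := fun g => by
    rw [map_sum]
    refine Fintype.sum_equiv (Equiv.mulLeft g) _ _ fun h => ?_
    simp
  rw [hinv, Submodule.mem_bot] at hsum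
  rw [centeredCoeff_apply, ← map_sum, hsum]
  simp

/-- The operator `∑ g, σ g ∘ T ∘ τ g⁻¹` as an intertwining map. -/
noncomputable def sumConj {K W W' : Type*} [Field K] [AddCommGroup W] [Module K W]
    [AddCommGroup W'] [Module K W'] (τ : Representation K G W') (σ : Representation K G W)
    (T : W' →ₗ[K] W) : IntertwiningMap τ σ where
  toLinearMap := ∑ g, σ g ∘ₗ T ∘ₗ τ g⁻¹
  isIntertwining' h := by
    refine LinearMap.ext fun x => ?_
    simp only [LinearMap.comp_apply, LinearMap.sum_apply, map_sum]
    refine (Fintype.sum_equiv (Equiv.mulLeft h) _ _ fun g => ?_).symm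
    simp only [Equiv.coe_mulLeft, mul_inv_rev, map_mul, Module.End.mul_apply]
    rw [← Module.End.mul_apply (τ h⁻¹), ← map_mul, inv_mul_cancel, map_one, Module.End.one_apply]

theorem sumConj_apply {K W W' : Type*} [Field K] [AddCommGroup W] [Module K W]
    [AddCommGroup W'] [Module K W'] (τ : Representation K G W') (σ : Representation K G W)
    (T : W' →ₗ[K] W) (x : W') : sumConj τ σ T x = ∑ g, σ g (T (τ g⁻¹ x)) := by
  simp [sumConj, LinearMap.sum_apply]

/-- Schur: averaging an endomorphism of an irreducible representation gives a scalar. -/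
theorem sumConj_self {W : Type*} [AddCommGroup W] [Module ℂ W] [FiniteDimensional ℂ W]
    {σ : Representation ℂ G W} (hσ : IsIrreducibleRep σ) (T : W →ₗ[ℂ] W) (x : W) :
    (Module.finrank ℂ W : ℂ) • sumConj σ σ T x =
      ((Fintype.card G : ℂ) * LinearMap.trace ℂ W T) • x := by
  have := hσ.isIrreducible
  obtain ⟨c, hc⟩ :=
    IsIrreducible.algebraMap_intertwiningMap_bijective_of_isAlgClosed.2 (sumConj σ σ T)
  have hc' (y : W) : sumConj σ σ T y = c • y := by
    rw [← hc]; rfl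
  have htr : LinearMap.trace ℂ W (sumConj σ σ T).toLinearMap =
      Fintype.card G * LinearMap.trace ℂ W T := by
    have (g : G) : LinearMap.trace ℂ W (σ g ∘ₗ T ∘ₗ σ g⁻¹) = LinearMap.trace ℂ W T := by
      rw [← LinearMap.comp_assoc, LinearMap.trace_comp_comm', ← LinearMap.comp_assoc,
        ← Module.End.mul_eq_comp (σ g⁻¹) (σ g), ← map_mul, inv_mul_cancel, map_one,
        Module.End.one_eq_id, LinearMap.id_comp]
    simp [sumConj, this]
  have hlin : (sumConj σ σ T).toLinearMap = c • LinearMap.id := LinearMap.ext hc'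
  rw [← htr, hlin, hc', map_smul, LinearMap.trace_id, smul_smul, smul_eq_mul, mul_comm]

/-- Matrix coefficients of pairwise non-isomorphic irreducible representations are linearly
independent. -/
theorem linearIndependent_coeff {ι : Type*} {d : ι → ℕ}
    (σ : (i : ι) → Representation ℂ G (Fin (d i) → ℂ)) (hirr : ∀ i, IsIrreducibleRep (σ i))
    (hdist : ∀ i j, i ≠ j → rchar (σ i) ≠ rchar (σ j)) :
    LinearIndependent ℂ fun (p : Σ i, Fin (d i) × Fin (d i)) (g : G) =>
      σ p.1 g (Pi.single p.2.2 1) p.2.1 := by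
  let D (q : Σ i, Fin (d i) × Fin (d i)) : Module.Dual ℂ (G → ℂ) :=
    ((d q.1 : ℂ) / Fintype.card G) •
      ∑ g, σ q.1 g⁻¹ (Pi.single q.2.1 1) q.2.2 • LinearMap.proj g
  have hD (p q : Σ i, Fin (d i) × Fin (d i)) :
      D q (fun g => σ p.1 g (Pi.single p.2.2 1) p.2.1) =
      (d q.1 : ℂ) / Fintype.card G * sumConj (σ q.1) (σ p.1)
        ((LinearMap.proj q.2.2).smulRight (Pi.single p.2.2 1)) (Pi.single q.2.1 1) p.2.1 := by
    simp [D, sumConj_apply, LinearMap.sum_apply, Finset.sum_apply]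
  have hself (i : ι) (a b a' b' : Fin (d i)) :
      D ⟨i, a, b⟩ (fun g => σ i g (Pi.single b' 1) a') =
        (Pi.single b' 1 : Fin (d i) → ℂ) b * (Pi.single a 1 : Fin (d i) → ℂ) a' := by
    have h := congrFun (sumConj_self (hirr i) ((LinearMap.proj b).smulRight (Pi.single b' 1))
      (Pi.single a 1)) a'
    rw [LinearMap.trace_smulRight] at h
    simp only [Module.finrank_fin_fun, Pi.smul_apply, smul_eq_mul, LinearMap.proj_apply] at h
    have hG : (Fintype.card G : ℂ) ≠ 0 := by simp
    rw [hD ⟨i, a', b'⟩ ⟨i, a, b⟩]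
    field_simp
    linear_combination h
  refine LinearIndependent.of_pairwise_dual_eq_zero_one _ D ?_ ?_
  · rintro ⟨i, a, b⟩ ⟨j, a', b'⟩ hne
    by_cases hij : i = j
    · subst hij
      refine (hself i a b a' b').trans ?_
      by_cases hb : b = b'
      · subst hb
        have : a' ≠ a := fun h => hne (by rw [h])
        simp [this]
      · simp [hb]
    · have : IsEmpty (Equiv (σ i) (σ j)) := ⟨fun e => hdist i j hij (char_iso e)⟩
      have := (hirr i).isIrreducible
      have := (hirr j).isIrreducible
      rw [hD, Subsingleton.elim (sumConj (σ i) (σ j) _) 0]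
      simp
  · rintro ⟨i, a, b⟩
    exact (hself i a b a b).trans (by simp)

theorem nonempty_equiv_of_rchar_eq {m n : ℕ} {σ : Representation ℂ G (Fin m → ℂ)}
    {τ : Representation ℂ G (Fin n → ℂ)} (hσ : IsIrreducibleRep σ) (hτ : IsIrreducibleRep τ)
    (h : rchar σ = rchar τ) : Nonempty (Equiv σ τ) := by
  have := hσ.isIrreducible
  have := hτ.isIrreducible
  have : Invertible (Nat.card G : ℂ) := invertibleOfNonzero (by simp)
  have h1 := char_orthonormal τ σ
  have h2 := char_orthonormal τ τ
  have h' : σ.character = τ.character := h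
  rw [h', h2, if_pos ⟨.refl τ⟩] at h1
  by_contra hne
  simp [hne] at h1

/-- Irreducible factors are detected by intertwining maps into the complexification. -/
theorem isFactor_iff {V W : Type*} [AddCommGroup V] [Module ℝ V] [AddCommGroup W] [Module ℂ W]
    [FiniteDimensional ℂ W] {ρ : Representation ℝ G V} {r : Representation ℂ G W}
    (hr : ∀ g, r.character g = (ρ.character g : ℂ)) {m : ℕ}
    (σ : Representation ℂ G (Fin m → ℂ)) :
    IsFactor σ ρ ↔ ∃ f : IntertwiningMap σ r, f ≠ 0 := by
  have : Invertible (Nat.card G : ℂ) := invertibleOfNonzero (by simp)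
  have h := card_inv_mul_sum_char_mul_char_eq_finrank σ r
  simp only [character_inv_eq_conj, hr, Nat.card_eq_fintype_card] at h
  unfold IsFactor
  unfold character at h
  rw [h]
  have : FiniteDimensional ℂ (IntertwiningMap σ r) :=
    FiniteDimensional.of_injective (⟨⟨fun f => f.toLinearMap, fun _ _ => rfl⟩, fun _ _ => rfl⟩ :
      IntertwiningMap σ r →ₗ[ℂ] _) (IntertwiningMap.toLinearMap_injective _ _)
  rw [Nat.cast_ne_zero, ← Nat.pos_iff_ne_zero, Module.finrank_pos_iff, nontrivial_iff_exists_ne 0]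

/-- The direction of the affine hull of finitely many points is spanned by their differences from
the mean. -/
theorem direction_affineSpan_range_eq_span_sub_mean {ι M : Type*} [Fintype ι] [Nonempty ι]
    [AddCommGroup M] [Module ℝ M] (u : ι → M) :
    (affineSpan ℝ (Set.range u)).direction =
      Submodule.span ℝ (Set.range fun i => u i - (Fintype.card ι : ℝ)⁻¹ • ∑ j, u j) := by
  rw [direction_affineSpan]
  apply le_antisymm
  · rw [vectorSpan_def, Submodule.span_le]
    rintro _ ⟨_, ⟨i, rfl⟩, _, ⟨j, rfl⟩, rfl⟩
    have := Submodule.sub_mem (Submodule.span ℝ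
        (Set.range fun i => u i - (Fintype.card ι : ℝ)⁻¹ • ∑ j, u j))
      (Submodule.subset_span ⟨i, rfl⟩) (Submodule.subset_span ⟨j, rfl⟩)
    simpa using this
  · rw [Submodule.span_le]
    rintro _ ⟨i, rfl⟩
    have : u i - (Fintype.card ι : ℝ)⁻¹ • ∑ j, u j =
        (Fintype.card ι : ℝ)⁻¹ • ∑ j, (u i -ᵥ u j) := by
      simp [smul_sub, Finset.sum_sub_distrib, ← Nat.cast_smul_eq_nsmul ℝ, smul_smul]
    simp only [this]
    exact Submodule.smul_mem _ _ (Submodule.sum_mem _ fun j _ =>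
      vsub_mem_vectorSpan ℝ ⟨i, rfl⟩ ⟨j, rfl⟩)

/-- The coefficient space of the complexification of a real representation is spanned by the matrix
coefficients of its nontrivial irreducible factors. -/
theorem span_centeredCoeff_eq_span_coeff {n : Type*} [Fintype n] [DecidableEq n] {V : Type*}
    [AddCommGroup V] [Module ℝ V] {ρ : Representation ℝ G V} {r : Representation ℂ G (n → ℂ)}
    (hr : ∀ g, r.character g = (ρ.character g : ℂ)) {ι : Type*} {d : ι → ℕ}
    (σ : (i : ι) → Representation ℂ G (Fin (d i) → ℂ))
    (hirr : ∀ i, IsIrreducibleRep (σ i)) (hnontriv : ∀ i, ∃ g : G, (σ i) g ≠ 1)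
    (hfac : ∀ i, IsFactor (σ i) ρ)
    (hcompl : ∀ (m : ℕ) (τ : Representation ℂ G (Fin m → ℂ)),
      IsIrreducibleRep τ → (∃ g : G, τ g ≠ 1) → IsFactor τ ρ → ∃ i, rchar τ = rchar (σ i)) :
    Submodule.span ℂ (Set.range fun p : n × n =>
      centeredCoeff r (LinearMap.proj p.1) (Pi.single p.2 1)) =
    Submodule.span ℂ (Set.range fun (p : Σ i, Fin (d i) × Fin (d i)) (g : G) =>
      σ p.1 g (Pi.single p.2.2 1) p.2.1) := by
  have hσ : (fun (p : Σ i, Fin (d i) × Fin (d i)) (g : G) =>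
      σ p.1 g (Pi.single p.2.2 1) p.2.1) = fun p =>
      centeredCoeff (σ p.1) (LinearMap.proj p.2.1) (Pi.single p.2.2 1) := by
    funext p g
    rw [centeredCoeff_apply_of_isIrreducibleRep (hirr p.1) (hnontriv p.1)]
    rfl
  rw [hσ]
  apply le_antisymm
  · let S := Submodule.span ℂ (Set.range fun p : Σ i, Fin (d i) × Fin (d i) =>
      centeredCoeff (σ p.1) (LinearMap.proj p.2.1) (Pi.single p.2.2 1))
    let T : Submodule ℂ (n → ℂ) := ⨅ φ : Module.Dual ℂ (n → ℂ), S.comap (centeredCoeff r φ)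
    have hT : T = ⊤ := by
      refine eq_top_of_forall_intertwiningMap_mem r T fun m τ hτ f x => ?_
      simp only [T, Submodule.mem_iInf, Submodule.mem_comap]
      intro φ
      rw [centeredCoeff_intertwiningMap]
      by_cases hnt : ∃ g, τ g ≠ 1
      · by_cases hf : f = 0
        · simp [hf]
        obtain ⟨i, hi⟩ := hcompl m τ hτ hnt ((isFactor_iff hr τ).mpr ⟨f, hf⟩)
        obtain ⟨e⟩ := nonempty_equiv_of_rchar_eq (hirr i) hτ hi.symm
        rw [← e.apply_symm_apply x, ← Equiv.coe_toIntertwiningMap, centeredCoeff_intertwiningMap]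
        refine Submodule.span_mono ?_ (centeredCoeff_mem_span (σ i) _ _)
        rintro _ ⟨p, rfl⟩
        exact ⟨⟨i, p⟩, rfl⟩
      · push Not at hnt
        convert S.zero_mem
        ext g
        simp [centeredCoeff_apply, hnt]
    rw [Submodule.span_le]
    rintro _ ⟨p, rfl⟩
    have : (Pi.single p.2 1 : n → ℂ) ∈ T := hT ▸ Submodule.mem_top
    simp only [T, Submodule.mem_iInf, Submodule.mem_comap] at this
    exact this _
  · rw [Submodule.span_le]
    rintro _ ⟨⟨i, a, b⟩, rfl⟩
    obtain ⟨f, hf⟩ := (isFactor_iff hr (σ i)).mp (hfac i)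
    have := (hirr i).isIrreducible
    have hinj := (IsIrreducible.injective_or_eq_zero f).resolve_right hf
    obtain ⟨l, hl⟩ := f.toLinearMap.exists_leftInverse_of_injective (LinearMap.ker_eq_bot.mpr hinj)
    have : (LinearMap.proj a : Module.Dual ℂ (Fin (d i) → ℂ)) =
        ((LinearMap.proj a) ∘ₗ l) ∘ₗ f.toLinearMap := by
      rw [LinearMap.comp_assoc, hl, LinearMap.comp_id]
    simp only
    rw [this, ← centeredCoeff_intertwiningMap]
    exact centeredCoeff_mem_span r _ _

/-- The complexification of a real representation in coordinates. -/
noncomputable def complexify {V n : Type*} [AddCommGroup V] [Module ℝ V] [Fintype n]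
    [DecidableEq n] (b : Module.Basis n ℝ V) (ρ : Representation ℝ G V) :
    Representation ℂ G (n → ℂ) :=
  (Matrix.toLinAlgEquiv' : _ ≃ₐ[ℂ] _).toMonoidHom.comp
    (Complex.ofRealHom.mapMatrix.toMonoidHom.comp
      ((LinearMap.toMatrixAlgEquiv b).toMulEquiv.toMonoidHom.comp ρ))

theorem complexify_apply_single {V n : Type*} [AddCommGroup V] [Module ℝ V] [Fintype n]
    [DecidableEq n] (b : Module.Basis n ℝ V) (ρ : Representation ℝ G V) (g : G) (i j : n) :
    complexify b ρ g (Pi.single j 1) i = (LinearMap.toMatrix b b (ρ g) i j : ℂ) := by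
  simp [complexify, LinearMap.toMatrixAlgEquiv]

theorem character_complexify {V n : Type*} [AddCommGroup V] [Module ℝ V] [Fintype n]
    [DecidableEq n] (b : Module.Basis n ℝ V) (ρ : Representation ℝ G V) (g : G) :
    (complexify b ρ).character g = (ρ.character g : ℂ) := by
  rw [character, character, LinearMap.trace_eq_matrix_trace ℂ (Pi.basisFun ℂ n),
    LinearMap.trace_eq_matrix_trace ℝ b, Matrix.trace, Matrix.trace]
  simp [LinearMap.toMatrix_apply, complexify_apply_single]

end

/-- Guralnick–Perkinson dimension formula.  If `σ i`, `i : Fin k`, is a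
complete list of pairwise non-isomorphic (= pairwise distinct characters) nontrivial
irreducible complex factors of `ρ`, with `deg (σ i) = d i`, then the dimension of the
affine hull of `P(ρ)` equals `∑ i, (d i)²`. -/
theorem stmt_5 {V : Type*} [AddCommGroup V] [Module ℝ V] [FiniteDimensional ℝ V]
    (ρ : Representation ℝ G V) (k : ℕ) (d : Fin k → ℕ)
    (σ : (i : Fin k) → Representation ℂ G (Fin (d i) → ℂ))
    (hirr : ∀ i, IsIrreducibleRep (σ i))
    (hnontriv : ∀ i, ∃ g : G, (σ i) g ≠ 1)
    (hfac : ∀ i, IsFactor (σ i) ρ)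
    (hdist : ∀ i j, i ≠ j → rchar (σ i) ≠ rchar (σ j))
    (hcompl : ∀ (m : ℕ) (τ : Representation ℂ G (Fin m → ℂ)),
      IsIrreducibleRep τ → (∃ g : G, τ g ≠ 1) → IsFactor τ ρ →
        ∃ i, rchar τ = rchar (σ i)) :
    Module.finrank ℝ
      (affineSpan ℝ (convexHull ℝ (Set.range fun g => (ρ g : V →ₗ[ℝ] V)))).direction =
      ∑ i, (d i) ^ 2 := by
  let b := Module.finBasis ℝ V
  let u : G → V →ₗ[ℝ] V := fun g => ρ g - (Fintype.card G : ℝ)⁻¹ • ∑ h, ρ h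
  let X : Matrix G (Fin (Module.finrank ℝ V) × Fin (Module.finrank ℝ V)) ℝ :=
    Matrix.of fun g p => LinearMap.toMatrix b b (u g) p.1 p.2
  let e : (V →ₗ[ℝ] V) ≃ₗ[ℝ] (Fin (Module.finrank ℝ V) × Fin (Module.finrank ℝ V) → ℝ) :=
    LinearMap.toMatrix b b ≪≫ₗ (LinearEquiv.curry ℝ ℝ _ _).symm
  have hrow : Set.range X.row = e '' Set.range u := by
    rw [← Set.range_comp]
    rfl
  have hcol : (fun p g => (X.col p g : ℂ)) = fun p =>
      centeredCoeff (complexify b ρ) (LinearMap.proj p.1) (Pi.single p.2 1) := by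
    funext p g
    simp only [centeredCoeff_apply, LinearMap.proj_apply, complexify_apply_single]
    simp [X, u, Matrix.sum_apply]
  rw [affineSpan_convexHull, direction_affineSpan_range_eq_span_sub_mean]
  change Module.finrank ℝ (Submodule.span ℝ (Set.range u)) = _
  rw [← LinearEquiv.finrank_map_eq e, Submodule.map_span]
  change Module.finrank ℝ (Submodule.span ℝ (e '' Set.range u)) = _
  rw [← hrow, ← Matrix.rank_eq_finrank_span_row, Matrix.rank_eq_finrank_span_cols,
    ← finrank_span_ofReal_comp, hcol,
    span_centeredCoeff_eq_span_coeff (character_complexify b ρ) σ hirr hnontriv hfac hcompl,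
    finrank_span_eq_card (linearIndependent_coeff σ hirr hdist)]
  simp [sq]
end

section
/- (Guralnick–Perkinson) Let G ≤ S_n be a permutation group and g ∈ G. There exists a face F of the permutation polytope P(G) that contains the matrices M_e and M_g and is contained in every face of P(G) containing M_e and M_g (the smallest face F_g), and the set of extreme points of F is exactly { M_h : h ∈ G and h is a subelement of g }. In particular, the segment [M_e, M_g] is an edge of P(G) if and only if g is indecomposable in G, i.e., e and g are the only subelements of g lying in G. -/
/-- The permutation matrix of `σ ∈ S_n`: entry `(i, j)` is `1` iff `σ j = i`. -/
def permMat {n : ℕ} (σ : Equiv.Perm (Fin n)) : Matrix (Fin n) (Fin n) ℝ :=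
  Matrix.of fun i j => if σ j = i then 1 else 0

/-- The permutation polytope of a permutation group `G ≤ S_n`. -/
def permPoly {n : ℕ} (G : Subgroup (Equiv.Perm (Fin n))) :
    Set (Matrix (Fin n) (Fin n) ℝ) :=
  convexHull ℝ {M | ∃ g ∈ G, M = permMat g}

/-- `h` is a subelement of `g`: the product of a subset of the disjoint cycles of `g`. -/
def IsSubelement {n : ℕ} (g h : Equiv.Perm (Fin n)) : Prop :=
  ∃ (I : Finset (Equiv.Perm (Fin n))) (hI : I ⊆ g.cycleFactorsFinset),
    h = I.noncommProd id
      ((Equiv.Perm.cycleFactorsFinset_mem_commute g).mono (Finset.coe_subset.mpr hI))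

section Subelement

variable {n : ℕ} {g h : Equiv.Perm (Fin n)}

/-- A subelement of `g` is a permutation that agrees at every point with `g` or the identity. -/
theorem isSubelement_iff_forall_apply : IsSubelement g h ↔ ∀ j, h j = j ∨ h j = g j := by
  constructor
  · rintro ⟨I, hI, rfl⟩ j
    have hc := Equiv.Perm.cycleFactorsFinset_mem_commute g
    have hd := Equiv.Perm.cycleFactorsFinset_pairwise_disjoint g
    have hs : I ∪ (g.cycleFactorsFinset \ I) = g.cycleFactorsFinset :=
      Finset.union_sdiff_of_subset hI
    have hprod := Finset.noncommProd_union_of_disjoint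
      (Finset.disjoint_sdiff (s := I) (t := g.cycleFactorsFinset)) id (by rw [hs]; exact hc)
    simp only [hs] at hprod
    replace hprod := (Equiv.Perm.cycleFactorsFinset_noncommProd g).symm.trans hprod
    have hdisj : (I.noncommProd id (hc.mono (Finset.coe_subset.mpr hI))).Disjoint
        ((g.cycleFactorsFinset \ I).noncommProd id
          (hc.mono (Finset.coe_subset.mpr Finset.sdiff_subset))) := by
      refine Equiv.Perm.disjoint_noncommProd_right _ fun c hcI => ?_
      refine (Equiv.Perm.disjoint_noncommProd_right _ fun d hdI => ?_).symm
      rw [Finset.mem_sdiff] at hcI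
      exact hd hcI.1 (hI hdI) fun hcd => hcI.2 (by simpa [hcd] using hdI)
    refine (hdisj j).imp id fun hj => ?_
    conv_rhs => rw [hprod, Equiv.Perm.mul_apply]
    rw [hj]
  · intro H
    have hdisj : h.Disjoint (h⁻¹ * g) := fun x => (H x).imp id fun hx => by
      simp [← hx]
    have hu := hdisj.cycleFactorsFinset_mul_eq_union
    rw [mul_inv_cancel_left] at hu
    exact ⟨h.cycleFactorsFinset, hu ▸ Finset.subset_union_left,
      (Equiv.Perm.cycleFactorsFinset_noncommProd h _).symm⟩

theorem isSubelement_one : IsSubelement g 1 :=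
  isSubelement_iff_forall_apply.2 fun _ => Or.inl rfl

theorem isSubelement_self : IsSubelement g g :=
  isSubelement_iff_forall_apply.2 fun _ => Or.inr rfl

theorem IsSubelement.permMat_add (H : IsSubelement g h) :
    permMat h + permMat (g * h⁻¹) = permMat 1 + permMat g := by
  rw [isSubelement_iff_forall_apply] at H
  ext i j
  simp only [permMat, Matrix.add_apply, Matrix.of_apply]
  rw [Equiv.Perm.one_apply]
  rcases H j with hj | hj
  · have hk : (g * h⁻¹) j = g j := by
      rw [Equiv.Perm.mul_apply, Equiv.Perm.inv_eq_iff_eq.2 hj.symm]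
    rw [hk, hj]
  · have hk : (g * h⁻¹) j = j := by
      have hh : h (h⁻¹ j) = j := h.apply_symm_apply j
      rw [Equiv.Perm.mul_apply]
      rcases H (h⁻¹ j) with hk | hk
      · rw [← hk, hh, ← hj, ← hh, hk, hk]
      · rw [← hk, hh]
    rw [hk, hj, add_comm]

end Subelement

section PermMat

variable {n : ℕ}

theorem permMat_eq_permMatrix_inv (σ : Equiv.Perm (Fin n)) :
    permMat σ = (σ⁻¹).permMatrix ℝ := by
  ext i j
  simp [permMat, Equiv.Perm.permMatrix, PEquiv.toMatrix_apply, Equiv.symm_apply_eq,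
    eq_comm (a := i)]

theorem permMat_injective :
    Function.Injective (permMat : Equiv.Perm (Fin n) → Matrix (Fin n) (Fin n) ℝ) := by
  intro σ τ hστ
  ext1 j
  have := congrFun (congrFun hστ (σ j)) j
  simp only [permMat, Matrix.of_apply, if_true] at this
  by_contra hne
  rw [if_neg (Ne.symm hne)] at this
  exact one_ne_zero this

theorem permMat_mem_permPoly {G : Subgroup (Equiv.Perm (Fin n))} {g : Equiv.Perm (Fin n)}
    (hg : g ∈ G) : permMat g ∈ permPoly G :=
  subset_convexHull ℝ _ ⟨g, hg, rfl⟩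

/-- The set of permutation matrices is in convex position. -/
theorem extremePoints_convexHull_image_permMat (S : Set (Equiv.Perm (Fin n))) :
    Set.extremePoints ℝ (convexHull ℝ (permMat '' S)) = permMat '' S := by
  have hext (σ : Equiv.Perm (Fin n)) :
      permMat σ ∈ Set.extremePoints ℝ (doublyStochastic ℝ (Fin n) : Set _) := by
    rw [extremePoints_doublyStochastic]
    exact ⟨σ⁻¹, (permMat_eq_permMatrix_inv σ).symm⟩
  have hsub : convexHull ℝ (permMat '' S) ⊆ (doublyStochastic ℝ (Fin n) : Set _) := by
    refine convexHull_min ?_ convex_doublyStochastic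
    rintro _ ⟨σ, -, rfl⟩
    exact (hext σ).1
  refine extremePoints_convexHull_subset.antisymm ?_
  rintro _ ⟨σ, hσ, rfl⟩
  exact inter_extremePoints_subset_extremePoints_of_subset hsub
    ⟨subset_convexHull ℝ _ ⟨σ, hσ, rfl⟩, hext σ⟩

/-- The functional adding up the entries `(i, j)` with `i = j` or `i = g j`. -/
noncomputable def supportFunctional (g : Equiv.Perm (Fin n)) :
    Matrix (Fin n) (Fin n) ℝ →ₗ[ℝ] ℝ where
  toFun M := ∑ j, ∑ i, if i = j ∨ i = g j then M i j else 0
  map_add' M N := by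
    simp only [← Finset.sum_add_distrib, Matrix.add_apply, ite_add_ite, add_zero]
  map_smul' c M := by
    simp only [Finset.mul_sum, Matrix.smul_apply, smul_eq_mul, RingHom.id_apply, mul_ite,
      mul_zero]

theorem supportFunctional_apply (g : Equiv.Perm (Fin n)) (M : Matrix (Fin n) (Fin n) ℝ) :
    supportFunctional g M = ∑ j, ∑ i, if i = j ∨ i = g j then M i j else 0 :=
  rfl

theorem supportFunctional_permMat (g h : Equiv.Perm (Fin n)) :
    supportFunctional g (permMat h) = ∑ j, if h j = j ∨ h j = g j then 1 else 0 := by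
  rw [supportFunctional_apply]
  refine Finset.sum_congr rfl fun j _ => ?_
  rw [Finset.sum_eq_single (h j)]
  · simp [permMat]
  · intro i _ hi
    simp [permMat, hi.symm]
  · simp

theorem supportFunctional_permMat_le (g h : Equiv.Perm (Fin n)) :
    supportFunctional g (permMat h) ≤ n := by
  rw [supportFunctional_permMat]
  calc (∑ j, if h j = j ∨ h j = g j then (1 : ℝ) else 0) ≤ ∑ _j : Fin n, 1 :=
        Finset.sum_le_sum fun j _ => by split_ifs <;> norm_num
    _ = n := by simp

theorem supportFunctional_permMat_eq_iff {g h : Equiv.Perm (Fin n)} :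
    supportFunctional g (permMat h) = n ↔ IsSubelement g h := by
  rw [supportFunctional_permMat, isSubelement_iff_forall_apply]
  have hn : (n : ℝ) = ∑ _j : Fin n, 1 := by simp
  rw [hn, Finset.sum_eq_sum_iff_of_le fun j _ => by split_ifs <;> norm_num]
  simp [or_iff_not_imp_left]

end PermMat

/-- The points of a convex hull where a functional attains a bound valid on the generators
are convex combinations of generators attaining the bound. -/
theorem mem_convexHull_of_linearMap_eq {E : Type*} [AddCommGroup E] [Module ℝ E] {S : Set E}
    {l : E →ₗ[ℝ] ℝ} {c : ℝ} (hl : ∀ x ∈ S, l x ≤ c) {x : E} (hx : x ∈ convexHull ℝ S)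
    (hxc : l x = c) : x ∈ convexHull ℝ {y ∈ S | l y = c} := by
  suffices h : convexHull ℝ S ⊆ {x | l x ≤ c ∧ (l x = c → x ∈ convexHull ℝ {y ∈ S | l y = c})} from
    (h hx).2 hxc
  refine convexHull_min (fun y hy => ⟨hl y hy, fun hc => subset_convexHull ℝ _ ⟨hy, hc⟩⟩) ?_
  rw [convex_iff_forall_pos]
  rintro y ⟨hy, hyc⟩ z ⟨hz, hzc⟩ a b ha hb hab
  have hlyz : l (a • y + b • z) = a * l y + b * l z := by simp
  have hc : a * c + b * c = c := by rw [← add_mul, hab, one_mul]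
  have hay := mul_le_mul_of_nonneg_left hy ha.le
  have hbz := mul_le_mul_of_nonneg_left hz hb.le
  refine ⟨by rw [hlyz]; linarith, fun heq => ?_⟩
  rw [hlyz] at heq
  exact convex_convexHull ℝ _
    (hyc (mul_left_cancel₀ ha.ne' (by linarith))) (hzc (mul_left_cancel₀ hb.ne' (by linarith)))
    ha.le hb.le hab

section Face

variable {n : ℕ} {G : Subgroup (Equiv.Perm (Fin n))} {g : Equiv.Perm (Fin n)}

/-- The subelements of `g` in `G` span a face of the permutation polytope. -/
theorem isExposed_convexHull_subelements (hg : g ∈ G) :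
    IsExposed ℝ (permPoly G) (convexHull ℝ (permMat '' {h | h ∈ G ∧ IsSubelement g h})) := by
  intro _
  refine ⟨LinearMap.toContinuousLinearMap (supportFunctional g), ?_⟩
  simp only [LinearMap.coe_toContinuousLinearMap']
  have hle : ∀ x ∈ permPoly G, supportFunctional g x ≤ n := by
    refine convexHull_min ?_ (convex_halfSpace_le (supportFunctional g).isLinear _)
    rintro _ ⟨h, -, rfl⟩
    exact supportFunctional_permMat_le g h
  refine Set.Subset.antisymm (fun x hx => ⟨?_, fun y hy => ?_⟩) ?_
  · refine convexHull_mono ?_ hx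
    rintro _ ⟨h, hh, rfl⟩
    exact ⟨h, hh.1, rfl⟩
  · refine (hle y hy).trans_eq (Eq.symm ?_)
    refine convexHull_min (t := {x | supportFunctional g x = n}) ?_
      (convex_hyperplane (supportFunctional g).isLinear _) hx
    rintro _ ⟨h, hh, rfl⟩
    exact supportFunctional_permMat_eq_iff.2 hh.2
  · rintro x ⟨hx, hmax⟩
    have hxn : supportFunctional g x = n := (hle x hx).antisymm <|
      (supportFunctional_permMat_eq_iff.2 isSubelement_self).symm.trans_le
        (hmax _ (permMat_mem_permPoly hg))
    refine convexHull_mono ?_ (mem_convexHull_of_linearMap_eq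
      (fun y hy => hle y (subset_convexHull ℝ _ hy)) hx hxn)
    rintro _ ⟨⟨h, hh, rfl⟩, hn⟩
    exact ⟨h, ⟨hh, supportFunctional_permMat_eq_iff.1 hn⟩, rfl⟩

/-- Every face containing `M_e` and `M_g` contains the matrices of the subelements of `g`. -/
theorem convexHull_subelements_subset (hg : g ∈ G) {F : Set (Matrix (Fin n) (Fin n) ℝ)}
    (hF : IsExposed ℝ (permPoly G) F) (h1F : permMat 1 ∈ F) (hgF : permMat g ∈ F) :
    convexHull ℝ (permMat '' {h | h ∈ G ∧ IsSubelement g h}) ⊆ F := by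
  refine convexHull_min ?_ (hF.convex (convex_convexHull ℝ _))
  obtain ⟨l, rfl⟩ := hF ⟨_, h1F⟩
  rintro _ ⟨h, ⟨hh, hsub⟩, rfl⟩
  refine ⟨permMat_mem_permPoly hh, fun y hy => ?_⟩
  have hadd := congrArg l hsub.permMat_add
  rw [map_add, map_add] at hadd
  have := h1F.2 y hy
  have := hgF.2 _ (permMat_mem_permPoly (G.mul_mem hg (G.inv_mem hh)))
  linarith

end Face

/-- Guralnick–Perkinson.  For `g ∈ G` there is a smallest face `F_g`
of `P(G)` containing `M_e` and `M_g`; its vertices are exactly the matrices of the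
subelements of `g` lying in `G`.  In particular `[M_e, M_g]` is an edge of `P(G)` iff
`g` is indecomposable in `G`. -/
theorem stmt_10 (n : ℕ) (G : Subgroup (Equiv.Perm (Fin n)))
    (g : Equiv.Perm (Fin n)) (hg : g ∈ G) :
    ∃ F : Set (Matrix (Fin n) (Fin n) ℝ),
      IsExposed ℝ (permPoly G) F ∧
      permMat 1 ∈ F ∧ permMat g ∈ F ∧
      (∀ F' : Set (Matrix (Fin n) (Fin n) ℝ),
        IsExposed ℝ (permPoly G) F' → permMat 1 ∈ F' → permMat g ∈ F' → F ⊆ F') ∧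
      Set.extremePoints ℝ F = {M | ∃ h ∈ G, IsSubelement g h ∧ M = permMat h} ∧
      (IsExposed ℝ (permPoly G) (segment ℝ (permMat 1) (permMat g)) ↔
        ∀ h ∈ G, IsSubelement g h → h = 1 ∨ h = g) := by
  have h1S : (1 : Equiv.Perm (Fin n)) ∈ {h | h ∈ G ∧ IsSubelement g h} :=
    ⟨G.one_mem, isSubelement_one⟩
  have hgS : g ∈ {h | h ∈ G ∧ IsSubelement g h} := ⟨hg, isSubelement_self⟩
  have hpair : segment ℝ (permMat 1) (permMat g) = convexHull ℝ (permMat '' {1, g}) := by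
    rw [Set.image_pair, convexHull_pair]
  refine ⟨convexHull ℝ (permMat '' {h | h ∈ G ∧ IsSubelement g h}),
    isExposed_convexHull_subelements hg, subset_convexHull ℝ _ ⟨1, h1S, rfl⟩,
    subset_convexHull ℝ _ ⟨g, hgS, rfl⟩,
    fun F hF h1F hgF => convexHull_subelements_subset hg hF h1F hgF, ?_, fun hseg h hh hsub => ?_,
    fun hind => ?_⟩
  · rw [extremePoints_convexHull_image_permMat]
    ext M
    constructor
    · rintro ⟨h, ⟨hh, hsub⟩, rfl⟩
      exact ⟨h, hh, hsub, rfl⟩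
    · rintro ⟨h, hh, hsub, rfl⟩
      exact ⟨h, ⟨hh, hsub⟩, rfl⟩
  · have hsubset := convexHull_subelements_subset hg hseg (left_mem_segment ℝ _ _)
      (right_mem_segment ℝ _ _)
    have hmem := hsubset (subset_convexHull ℝ _ ⟨h, ⟨hh, hsub⟩, rfl⟩)
    have hinsert : permMat h ∈
        Set.extremePoints ℝ (convexHull ℝ (permMat '' {h, 1, g})) := by
      rw [extremePoints_convexHull_image_permMat]
      exact ⟨h, Set.mem_insert _ _, rfl⟩
    rw [hpair] at hmem
    have hext := inter_extremePoints_subset_extremePoints_of_subset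
      (convexHull_mono (Set.image_mono (Set.subset_insert h {1, g}))) ⟨hmem, hinsert⟩
    obtain ⟨k, hk, hkh⟩ := extremePoints_convexHull_subset hext
    exact permMat_injective hkh ▸ hk
  · have hS : {h | h ∈ G ∧ IsSubelement g h} = {1, g} := by
      refine Set.Subset.antisymm (fun h hh => hind h hh.1 hh.2) ?_
      rintro h (rfl | rfl)
      exacts [h1S, hgS]
    rw [hpair, ← hS]
    exact isExposed_convexHull_subelements hg
end
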